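/- Let p be an odd prime, n ≥ 1, and A = (a_{ij}) a symmetric n×n integer matrix with gcd(det A, p) = 1; write Q(y) = y^t A y. Let m, r be integers with 0 ≤ r ≤ m − 2 and m − r even, let l ∈ ℤ with p ∤ l, and let L = (l₁,...,lₙ)^t ∈ ℤ^n. Then Σ_{y₁,...,yₙ=1}^{p^m} e_{p^m}( l p^r Q(y) + p^r Σ_{i=1}^n lᵢ yᵢ ) = p^{(m+r)n/2} · e_{p^{m−r}}( C · l̄ · Q'(L) ), where Q'(L) = L^t adj(A)^t L, C = −(2 det A)̄ (1 − 2̄), l̄ is the inverse of l modulo p^{m−r}, and the inverses in C are taken modulo p^{m−r}. -/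

import Mathlib

/-- The additive character `e_q(a) = e^{2πia/q}`, defined on residues modulo `q`. -/
noncomputable def eChar (q : ℕ) (a : ZMod q) : ℂ :=
  Complex.exp (2 * Real.pi * Complex.I * (a.val : ℂ) / (q : ℂ))

/-- The exponential sum
`E(l₁p^r, …, lₙp^r, lp^r; p^m) = Σ_{y₁,…,yₙ=1}^{p^m} e_{p^m}(lp^r Q(y) + p^r Σ lᵢyᵢ)`,
where `Q(y) = yᵗAy`. -/
noncomputable def Esum (p : ℕ) [NeZero p] (m r : ℕ) {n : ℕ}
    (A : Matrix (Fin n) (Fin n) ℤ) (L : Fin n → ℤ) (l : ℤ) : ℂ :=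
  ∑ y : Fin n → ZMod (p ^ m),
    eChar (p ^ m)
      (((l * (p : ℤ) ^ r * (∑ i, ∑ j, A i j * ((y i).val : ℤ) * ((y j).val : ℤ))
          + (p : ℤ) ^ r * ∑ i, L i * ((y i).val : ℤ) : ℤ) : ZMod (p ^ m)))

open Matrix

/-- Orthogonality of the characters `w ↦ ψ (v ⬝ᵥ w)`. -/
theorem AddChar.IsPrimitive.sum_dotProduct {R ι : Type*} [CommRing R] [Fintype R] [DecidableEq R]
    [Fintype ι] [DecidableEq ι] {ψ : AddChar R ℂ} (hψ : ψ.IsPrimitive) (v : ι → R) :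
    ∑ w : ι → R, ψ (v ⬝ᵥ w) = if v = 0 then (Fintype.card (ι → R) : ℂ) else 0 := by
  have h (w : ι → R) : ψ (v ⬝ᵥ w) = ∏ i, ψ (w i * v i) := by
    simp only [dotProduct, mul_comm (v _)]
    exact map_prod ψ.toMonoidHom (fun i => Multiplicative.ofAdd (w i * v i)) Finset.univ
  have hprod := Finset.prod_univ_sum (fun _ : ι => (Finset.univ : Finset R))
    (fun i x => ψ (x * v i))
  rw [Fintype.piFinset_univ] at hprod
  simp only [h, ← hprod, AddChar.sum_mulShift _ hψ]
  split_ifs with hv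
  · simp [hv]
  · obtain ⟨i, hi⟩ := Function.ne_iff.mp hv
    exact Finset.prod_eq_zero (Finset.mem_univ i) (by simpa using hi)

/-- The sum of a function pulled back along a surjective homomorphism of finite groups. -/
theorem AddMonoidHom.card_mul_sum_comp {G H : Type*} [AddGroup G] [AddGroup H] [Fintype G]
    [Fintype H] (f : G →+ H) (hf : Function.Surjective f) (F : H → ℂ) :
    (Fintype.card H : ℂ) * ∑ g, F (f g) = Fintype.card G * ∑ h, F h := by
  classical
  have hcard (h : H) : (Finset.univ.filter fun g => f g = h).card
      = (Finset.univ.filter fun g => f g = 0).card :=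
    AddMonoidHom.card_fiber_eq_of_mem_range f (hf h) (hf 0)
  have hG : Fintype.card G
      = Fintype.card H * (Finset.univ.filter fun g => f g = 0).card := by
    rw [← Finset.card_univ, Finset.card_eq_sum_card_fiberwise (f := f) (t := Finset.univ)
      (fun _ _ => Finset.mem_coe.mpr (Finset.mem_univ _)), Finset.sum_congr rfl fun h _ => hcard h]
    simp
  have hsum : ∑ g, F (f g) = (Finset.univ.filter fun g => f g = 0).card * ∑ h, F h := by
    rw [← Finset.sum_fiberwise (s := Finset.univ) (g := f), Finset.mul_sum]
    refine Finset.sum_congr rfl fun h _ => ?_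
    rw [← hcard h, ← nsmul_eq_mul, ← Finset.sum_const]
    exact Finset.sum_congr rfl fun g hg => by rw [(Finset.mem_filter.mp hg).2]
  rw [hsum, hG]
  push_cast
  ring

/-- If the annihilator of `t` is the ideal generated by `t`, its order is the square root of the
order of the ring. -/
theorem card_annihilator_sq {R : Type*} [CommRing R] [Fintype R] [DecidableEq R] (t : R)
    (ht : ∀ x, t * x = 0 ↔ ∃ y, t * y = x) :
    Fintype.card {x : R // t * x = 0} ^ 2 = Fintype.card R := by
  have hker : (AddMonoidHom.mulLeft t).ker = (AddMonoidHom.mulLeft t).range := by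
    ext x
    simpa [AddMonoidHom.mem_ker] using ht x
  have hcard : Nat.card (AddMonoidHom.mulLeft t).ker = Fintype.card {x : R // t * x = 0} := by
    rw [← Nat.card_eq_fintype_card]
    rfl
  have h := (AddMonoidHom.mulLeft t).ker.card_mul_index
  rw [AddSubgroup.index_ker, ← hker, hcard, Nat.card_eq_fintype_card] at h
  rw [sq, h]

theorem Matrix.IsSymm.dotProduct_mulVec_comm {R ι : Type*} [CommRing R] [Fintype ι]
    {B : Matrix ι ι R} (hB : B.IsSymm) (v w : ι → R) : v ⬝ᵥ B *ᵥ w = w ⬝ᵥ B *ᵥ v := by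
  rw [dotProduct_mulVec, ← mulVec_transpose, hB.eq, dotProduct_comm]

/-- The Gauss sum of a nondegenerate quadratic form over a finite ring possessing an element `t`
whose annihilator is `(t)`. -/
theorem AddChar.IsPrimitive.sum_quadraticForm {R ι : Type*} [CommRing R] [Fintype R]
    [DecidableEq R] [Fintype ι] [DecidableEq ι] {ψ : AddChar R ℂ} (hψ : ψ.IsPrimitive) (t : R)
    (ht : ∀ x, t * x = 0 ↔ ∃ y, t * y = x) (h2 : IsUnit (2 : R)) {B : Matrix ι ι R}
    (hB : B.IsSymm) (hdet : IsUnit B.det) :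
    ∑ z : ι → R, ψ (z ⬝ᵥ B *ᵥ z)
      = (Fintype.card {x : R // t * x = 0} : ℂ) ^ Fintype.card ι := by
  have htt : t * t = 0 := (ht t).mpr ⟨1, mul_one t⟩
  have hexpand (z w : ι → R) : (z + t • w) ⬝ᵥ B *ᵥ (z + t • w)
      = z ⬝ᵥ B *ᵥ z + ((2 * t) • B *ᵥ z) ⬝ᵥ w := by
    have hwz : (B *ᵥ z) ⬝ᵥ w = w ⬝ᵥ B *ᵥ z := dotProduct_comm _ _
    have hzw : z ⬝ᵥ B *ᵥ w = w ⬝ᵥ B *ᵥ z := hB.dotProduct_mulVec_comm z w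
    simp only [mulVec_add, mulVec_smul, add_dotProduct, dotProduct_add, smul_dotProduct,
      dotProduct_smul, smul_eq_mul, hwz, hzw]
    linear_combination (w ⬝ᵥ B *ᵥ w) * htt
  have hzero (z : ι → R) : (2 * t) • B *ᵥ z = 0 ↔ ∀ i, t * z i = 0 := by
    have h : (2 * t) • B *ᵥ z = (2 : R) • B *ᵥ (t • z) := by rw [mulVec_smul, smul_smul]
    rw [h, h2.smul_eq_zero, ← mulVec_zero B,
      (mulVec_injective_of_isUnit ((isUnit_iff_isUnit_det B).mpr hdet)).eq_iff,
      funext_iff]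
    rfl
  have hval (z : ι → R) (hz : ∀ i, t * z i = 0) : ψ (z ⬝ᵥ B *ᵥ z) = 1 := by
    choose y hy using fun i => (ht _).mp (hz i)
    have hzy : z = t • y := funext fun i => (hy i).symm
    rw [hzy, mulVec_smul, smul_dotProduct, dotProduct_smul, smul_smul, htt, zero_smul,
      AddChar.map_zero_eq_one]
  have hcard : (Finset.univ.filter fun z : ι → R => ∀ i, t * z i = 0).card
      = Fintype.card {x : R // t * x = 0} ^ Fintype.card ι := by
    rw [← Fintype.card_subtype, ← Fintype.card_fun,
      Fintype.card_congr (Equiv.subtypePiEquivPi (p := fun (_ : ι) x => t * x = 0))]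
  have hne : (Fintype.card (ι → R) : ℂ) ≠ 0 := Nat.cast_ne_zero.mpr Fintype.card_ne_zero
  refine mul_left_cancel₀ hne ?_
  calc (Fintype.card (ι → R) : ℂ) * ∑ z : ι → R, ψ (z ⬝ᵥ B *ᵥ z)
      = ∑ w : ι → R, ∑ z : ι → R, ψ ((z + t • w) ⬝ᵥ B *ᵥ (z + t • w)) := by
        have hshift (w : ι → R) : ∑ z : ι → R, ψ ((z + t • w) ⬝ᵥ B *ᵥ (z + t • w))
            = ∑ z : ι → R, ψ (z ⬝ᵥ B *ᵥ z) :=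
          Fintype.sum_equiv (Equiv.addRight (t • w)) _ _ fun _ => rfl
        simp only [hshift, Finset.sum_const, Finset.card_univ, nsmul_eq_mul]
    _ = ∑ z : ι → R, if ∀ i, t * z i = 0 then (Fintype.card (ι → R) : ℂ) else 0 := by
        rw [Finset.sum_comm]
        refine Finset.sum_congr rfl fun z _ => ?_
        simp only [hexpand, AddChar.map_add_eq_mul, ← Finset.mul_sum, hψ.sum_dotProduct, hzero]
        split_ifs with hz
        · rw [hval z hz, one_mul]
        · rw [mul_zero]
    _ = _ := by
        rw [← Finset.sum_filter, Finset.sum_const, hcard, nsmul_eq_mul]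
        push_cast
        ring

/-- Completing the square: the sum over a quadratic form with a linear term, where `c` is the
critical point of the phase. -/
theorem AddChar.IsPrimitive.sum_quadraticForm_add_linear {R ι : Type*} [CommRing R] [Fintype R]
    [DecidableEq R] [Fintype ι] [DecidableEq ι] {ψ : AddChar R ℂ} (hψ : ψ.IsPrimitive) (t : R)
    (ht : ∀ x, t * x = 0 ↔ ∃ y, t * y = x) (h2 : IsUnit (2 : R)) {B : Matrix ι ι R}
    (hB : B.IsSymm) (hdet : IsUnit B.det) (v c : ι → R) (hc : (2 : R) • B *ᵥ c = -v) :
    ∑ z : ι → R, ψ (z ⬝ᵥ B *ᵥ z + v ⬝ᵥ z)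
      = (Fintype.card {x : R // t * x = 0} : ℂ) ^ Fintype.card ι * ψ (-(c ⬝ᵥ B *ᵥ c)) := by
  have hv : v = -((2 : R) • B *ᵥ c) := by rw [hc, neg_neg]
  have hexpand (z : ι → R) : (z + c) ⬝ᵥ B *ᵥ (z + c) + v ⬝ᵥ (z + c)
      = z ⬝ᵥ B *ᵥ z + -(c ⬝ᵥ B *ᵥ c) := by
    have hzc : c ⬝ᵥ B *ᵥ z = z ⬝ᵥ B *ᵥ c := hB.dotProduct_mulVec_comm c z
    have hcz (w : ι → R) : (B *ᵥ c) ⬝ᵥ w = w ⬝ᵥ B *ᵥ c := dotProduct_comm _ _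
    simp only [hv, mulVec_add, add_dotProduct, dotProduct_add, neg_dotProduct, smul_dotProduct,
      smul_eq_mul, hzc, hcz]
    ring
  rw [← hψ.sum_quadraticForm t ht h2 hB hdet, Finset.sum_mul,
    ← Fintype.sum_equiv (Equiv.addRight c) _ _ fun _ => rfl]
  refine Finset.sum_congr rfl fun z _ => ?_
  rw [Equiv.coe_addRight, hexpand, AddChar.map_add_eq_mul]

/-- The explicit evaluation in terms of the adjugate matrix. The elements `k`, `i`, `e` are the
inverses of `l`, `2` and `2 * M.det`. -/
theorem AddChar.IsPrimitive.sum_quadraticForm_add_linear_adjugate {R ι : Type*} [CommRing R]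
    [Fintype R] [DecidableEq R] [Fintype ι] [DecidableEq ι] {ψ : AddChar R ℂ}
    (hψ : ψ.IsPrimitive) (t : R) (ht : ∀ x, t * x = 0 ↔ ∃ y, t * y = x) {M : Matrix ι ι R}
    (hM : M.IsSymm) {l k i e : R} (hk : l * k = 1) (hi : 2 * i = 1) (he : 2 * M.det * e = 1)
    (v : ι → R) :
    ∑ z : ι → R, ψ (l * (z ⬝ᵥ M *ᵥ z) + v ⬝ᵥ z)
      = (Fintype.card {x : R // t * x = 0} : ℂ) ^ Fintype.card ι
        * ψ (-e * (1 - i) * k * ((M.adjugate *ᵥ v) ⬝ᵥ v)) := by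
  have hdet : IsUnit (l • M).det := by
    rw [det_smul]
    exact ((IsUnit.of_mul_eq_one _ hk).pow _).mul
      (IsUnit.of_mul_eq_one (2 * e) (by linear_combination he))
  have hcrit : (l • M) *ᵥ (-(e * k)) • M.adjugate *ᵥ v = -((M.det * e) • v) := by
    rw [smul_mulVec, mulVec_smul, mulVec_mulVec, mul_adjugate, smul_mulVec, one_mulVec,
      smul_smul, smul_smul, ← neg_smul]
    congr 1
    linear_combination (-(e * M.det)) * hk
  have hsum := hψ.sum_quadraticForm_add_linear t ht (IsUnit.of_mul_eq_one _ hi) (hM.smul l) hdet v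
    ((-(e * k)) • M.adjugate *ᵥ v)
    (by rw [hcrit, smul_neg, smul_smul, ← mul_assoc, he, one_smul])
  simp only [hcrit, smul_mulVec, dotProduct_neg, dotProduct_smul, smul_dotProduct,
    smul_eq_mul] at hsum
  rw [hsum]
  congr 2
  linear_combination (e * k * ((M.adjugate *ᵥ v) ⬝ᵥ v)) * ((M.det * e - 1) * hi - i * he)

theorem eChar_eq_stdAddChar (q : ℕ) [NeZero q] (a : ZMod q) : eChar q a = ZMod.stdAddChar a := by
  rw [ZMod.stdAddChar_apply, ZMod.toCircle_apply, eChar]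

theorem eChar_mul_left (d q : ℕ) [NeZero d] [NeZero q] (a : ℤ) :
    eChar (d * q) ((d * a : ℤ) : ZMod (d * q)) = eChar q (a : ZMod q) := by
  rw [eChar_eq_stdAddChar, eChar_eq_stdAddChar, ZMod.stdAddChar_coe, ZMod.stdAddChar_coe]
  congr 1
  have hd : (d : ℂ) ≠ 0 := Nat.cast_ne_zero.mpr (NeZero.ne d)
  have hq : (q : ℂ) ≠ 0 := Nat.cast_ne_zero.mpr (NeZero.ne q)
  push_cast
  field_simp

/-- In `ℤ/q²ℤ` the annihilator of `q` is `(q)`. -/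
theorem ZMod.mul_eq_zero_iff_of_sq (q : ℕ) [NeZero q] (x : ZMod (q ^ 2)) :
    (q : ZMod (q ^ 2)) * x = 0 ↔ ∃ y, (q : ZMod (q ^ 2)) * y = x := by
  constructor
  · intro h
    obtain ⟨a, rfl⟩ := ZMod.natCast_zmod_surjective x
    rw [← Nat.cast_mul, ZMod.natCast_eq_zero_iff, sq] at h
    obtain ⟨b, rfl⟩ := Nat.dvd_of_mul_dvd_mul_left (NeZero.pos q) h
    exact ⟨b, by push_cast; ring⟩
  · rintro ⟨y, rfl⟩
    rw [← mul_assoc, ← sq, ← Nat.cast_pow, ZMod.natCast_self, zero_mul]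

theorem ZMod.intCast_mul_eq_one {q : ℕ} {a b : ℤ} (h : a * b ≡ 1 [ZMOD q]) :
    (a : ZMod q) * b = 1 := by
  have := (ZMod.intCast_eq_intCast_iff (a * b) 1 q).mpr h
  simpa only [Int.cast_mul, Int.cast_one] using this

/-- Evaluation \eqref{jan-4}, case `m - r` even: for an odd prime `p`, `A` symmetric with
`gcd(det A, p) = 1`, `0 ≤ r ≤ m - 2`, `m - r = 2s`, `p ∤ l`, one has
`E(l₁p^r, …, lₙp^r, lp^r; p^m) = p^{(m+r)n/2} e_{p^{m-r}}(C·l̄·Q'(L))`, where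
`Q'(L) = Lᵗ adj(A)ᵗ L`, `C = -(2 det A)̄ (1 - 2̄)`, and the bars denote multiplicative
inverses modulo `p^{m-r}`. -/
theorem stmt11 (p : ℕ) [NeZero p] (hp : p.Prime) (hodd : p ≠ 2)
    (n : ℕ) (hn : 1 ≤ n)
    (A : Matrix (Fin n) (Fin n) ℤ) (hA : A.IsSymm) (hdet : Int.gcd A.det (p : ℤ) = 1)
    (m r s : ℕ) (hr : r + 2 ≤ m) (hs : m = r + 2 * s)
    (l : ℤ) (hl : ¬ (p : ℤ) ∣ l)
    (linv : ℤ) (hlinv : l * linv ≡ 1 [ZMOD ((p : ℤ) ^ (2 * s))])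
    (inv2 : ℤ) (hinv2 : 2 * inv2 ≡ 1 [ZMOD ((p : ℤ) ^ (2 * s))])
    (invTwoDet : ℤ) (hinvTwoDet : (2 * A.det) * invTwoDet ≡ 1 [ZMOD ((p : ℤ) ^ (2 * s))])
    (L : Fin n → ℤ) :
    Esum p m r A L l
      = (p : ℂ) ^ ((r + s) * n) *
        eChar (p ^ (2 * s))
          (((-invTwoDet * (1 - inv2) * linv *
              (∑ i, ∑ j, A.adjugate j i * L i * L j) : ℤ) : ZMod (p ^ (2 * s)))) := by
  subst hs
  have hps : NeZero (p ^ s) := ⟨pow_ne_zero _ hp.ne_zero⟩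
  have hpow : (p : ℤ) ^ (2 * s) = (((p ^ s) ^ 2 : ℕ) : ℤ) := by push_cast; ring
  have hfac : p ^ (r + 2 * s) = p ^ r * (p ^ s) ^ 2 := by ring
  rw [hpow] at hlinv hinv2 hinvTwoDet
  rw [show p ^ (2 * s) = (p ^ s) ^ 2 by ring]
  have hl' := ZMod.intCast_mul_eq_one hlinv
  have h2 := ZMod.intCast_mul_eq_one hinv2
  have hd := ZMod.intCast_mul_eq_one hinvTwoDet
  let φ := Int.castRingHom (ZMod ((p ^ s) ^ 2))
  have hsymm : (A.map φ).IsSymm := by rw [Matrix.IsSymm, ← Matrix.transpose_map, hA.eq]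
  have hdetA : (A.map φ).det = (A.det : ZMod ((p ^ s) ^ 2)) := (φ.map_det A).symm
  have hadj : (A.map φ).adjugate = A.adjugate.map φ := (φ.map_adjugate A).symm
  rw [Int.cast_ofNat] at h2
  rw [Int.cast_mul, Int.cast_ofNat, ← hdetA] at hd
  let v : Fin n → ZMod ((p ^ s) ^ 2) := fun i => L i
  have hann := ZMod.mul_eq_zero_iff_of_sq (p ^ s)
  have hcardann : Fintype.card {x : ZMod ((p ^ s) ^ 2) // ((p ^ s : ℕ) : ZMod ((p ^ s) ^ 2)) * x = 0}
      = p ^ s := by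
    have h := card_annihilator_sq _ hann
    rw [ZMod.card] at h
    exact Nat.pow_left_injective two_ne_zero h
  have hgauss := (ZMod.isPrimitive_stdAddChar _).sum_quadraticForm_add_linear_adjugate _ hann hsymm
    hl' h2 hd v
  have hdvd : (p ^ s) ^ 2 ∣ p ^ (r + 2 * s) := hfac ▸ dvd_mul_left _ _
  let f : (Fin n → ZMod (p ^ (r + 2 * s))) →+ (Fin n → ZMod ((p ^ s) ^ 2)) :=
    (ZMod.castHom hdvd (ZMod ((p ^ s) ^ 2))).toAddMonoidHom.compLeft (Fin n)
  have hf : Function.Surjective f := (ZMod.castHom_surjective hdvd).comp_left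
  have hterm (y : Fin n → ZMod (p ^ (r + 2 * s))) :
      eChar (p ^ (r + 2 * s))
        (((l * (p : ℤ) ^ r * (∑ i, ∑ j, A i j * ((y i).val : ℤ) * ((y j).val : ℤ))
          + (p : ℤ) ^ r * ∑ i, L i * ((y i).val : ℤ) : ℤ) : ZMod (p ^ (r + 2 * s))))
      = ZMod.stdAddChar ((l : ZMod ((p ^ s) ^ 2)) * (f y ⬝ᵥ A.map φ *ᵥ f y) + v ⬝ᵥ f y) := by
    have hval (i : Fin n) : (((y i).val : ℤ) : ZMod ((p ^ s) ^ 2)) = f y i := by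
      rw [Int.cast_natCast, ZMod.natCast_val]
      rfl
    have hmul := eChar_mul_left (p ^ r) ((p ^ s) ^ 2)
      (l * (∑ i, ∑ j, A i j * ((y i).val : ℤ) * ((y j).val : ℤ)) + ∑ i, L i * ((y i).val : ℤ))
    rw [← hfac] at hmul
    rw [show l * (p : ℤ) ^ r * (∑ i, ∑ j, A i j * ((y i).val : ℤ) * ((y j).val : ℤ))
        + (p : ℤ) ^ r * ∑ i, L i * ((y i).val : ℤ)
        = ((p ^ r : ℕ) : ℤ) * (l * (∑ i, ∑ j, A i j * ((y i).val : ℤ) * ((y j).val : ℤ))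
          + ∑ i, L i * ((y i).val : ℤ)) by push_cast; ring, hmul, eChar_eq_stdAddChar]
    congr 1
    simp only [Int.cast_add, Int.cast_mul, Int.cast_sum, hval]
    congr 2
    simp only [dotProduct, mulVec, Finset.mul_sum, Matrix.map_apply]
    exact Finset.sum_congr rfl fun i _ => Finset.sum_congr rfl fun j _ => by
      rw [show φ (A i j) = (A i j : ZMod ((p ^ s) ^ 2)) from rfl]
      ring
  have hQ : ((∑ i, ∑ j, A.adjugate j i * L i * L j : ℤ) : ZMod ((p ^ s) ^ 2))
      = ((A.map φ).adjugate *ᵥ v) ⬝ᵥ v := by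
    rw [hadj, Finset.sum_comm]
    simp only [dotProduct, mulVec, Finset.sum_mul, Matrix.map_apply, Int.cast_sum, Int.cast_mul]
    rfl
  have hsum := f.card_mul_sum_comp hf fun z =>
    ZMod.stdAddChar ((l : ZMod ((p ^ s) ^ 2)) * (z ⬝ᵥ A.map φ *ᵥ z) + v ⬝ᵥ z)
  have hp0 : (p : ℂ) ≠ 0 := Nat.cast_ne_zero.mpr hp.ne_zero
  rw [hgauss, hcardann] at hsum
  rw [Esum, Finset.sum_congr rfl fun y _ => hterm y, eChar_eq_stdAddChar, Int.cast_mul, hQ]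
  refine mul_left_cancel₀ (pow_ne_zero n (pow_ne_zero 2 (pow_ne_zero s hp0))) ?_
  simp only [Fintype.card_fun, ZMod.card, Fintype.card_fin, Nat.cast_pow] at hsum
  rw [hsum]
  push_cast
  ring
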